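/- Let V be a grading-restricted vertex algebra and W a grading-restricted generalized V-module. The subspaces of Hom(V^{⊗n}, W̃_{z₁,…,zₙ}) consisting of linear maps having the L(−1)-derivative property, of linear maps having the L(0)-conjugation property, and of linear maps composable with m vertex operators, are each invariant under the action of Sₙ given by (σ(Φ))(v₁⊗⋯⊗vₙ) = σ(Φ(v_{σ(1)}⊗⋯⊗v_{σ(n)})). -/

import Mathlib

open scoped BigOperators Classical

noncomputable section VertexCohomology

/-! ## Rational functions with prescribed poles -/

/-- A function of `n` complex variables (restricted to the configuration space of
pairwise distinct points) which is a rational function with the only possible poles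
on the diagonals `z i = z j`, `i ≠ j`. -/
def RatDiag (n : ℕ) (f : (Fin n → ℂ) → ℂ) : Prop :=
  ∃ (P : MvPolynomial (Fin n) ℂ) (N : ℕ),
    ∀ z : Fin n → ℂ, (∀ i j : Fin n, i ≠ j → z i ≠ z j) →
      f z * ∏ i : Fin n, ∏ j : Fin n, (if i < j then (z i - z j) ^ N else 1)
        = MvPolynomial.eval z P

/-- A rational function of `n` variables with the only possible poles at
`z i = z j` (`i ≠ j`) and `z i = 0`. -/
def RatFull (n : ℕ) (f : (Fin n → ℂ) → ℂ) : Prop :=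
  ∃ (P : MvPolynomial (Fin n) ℂ) (N : ℕ),
    ∀ z : Fin n → ℂ, (∀ i, z i ≠ 0) → (∀ i j : Fin n, i ≠ j → z i ≠ z j) →
      f z * ((∏ i : Fin n, z i ^ N) *
        ∏ i : Fin n, ∏ j : Fin n, (if i < j then (z i - z j) ^ N else 1))
        = MvPolynomial.eval z P

/-- A rational function of `n` variables with the only possible poles at
`z i = z j` (`i ≠ j`), the pole at `z i = z j` being of order at most `Nb i j`. -/
def RatDiagBnd (n : ℕ) (Nb : Fin n → Fin n → ℕ) (f : (Fin n → ℂ) → ℂ) : Prop :=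
  ∃ P : MvPolynomial (Fin n) ℂ,
    ∀ z : Fin n → ℂ, (∀ i j : Fin n, i ≠ j → z i ≠ z j) →
      f z * ∏ i : Fin n, ∏ j : Fin n, (if i < j then (z i - z j) ^ (Nb i j) else 1)
        = MvPolynomial.eval z P

/-- A rational function of one variable with the only possible pole at `0`. -/
def RatOne (f : ℂ → ℂ) : Prop :=
  ∃ (P : Polynomial ℂ) (N : ℕ), ∀ z : ℂ, z ≠ 0 → f z * z ^ N = Polynomial.eval z P

/-! ## Graded duals -/

/-- A linear functional on a `ℤ`-graded space belonging to the graded (restricted) dual: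
it is nonzero on only finitely many homogeneous subspaces. -/
def GradedFunctionalZ {V : Type} [AddCommGroup V] [Module ℂ V]
    (grading : ℤ → Submodule ℂ V) (f : V →ₗ[ℂ] ℂ) : Prop :=
  {k : ℤ | ∃ v ∈ grading k, f v ≠ 0}.Finite

/-- A linear functional on a `ℂ`-graded space belonging to the graded (restricted) dual. -/
def GradedFunctionalC {W : Type} [AddCommGroup W] [Module ℂ W]
    (grading : ℂ → Submodule ℂ W) (f : W →ₗ[ℂ] ℂ) : Prop :=
  {c : ℂ | ∃ w ∈ grading c, f w ≠ 0}.Finite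

/-! ## Grading-restricted vertex algebras and modules -/

variable (V : Type) [AddCommGroup V] [Module ℂ V]
variable (W : Type) [AddCommGroup W] [Module ℂ W]

/-- A grading-restricted vertex algebra structure on `V`, with the duality property
(for products and iterates of two vertex operators) as the main axiom.
`Y u v k` denotes the coefficient `(Y_V)_k(u)v` of `x^{-k-1}` in `Y_V(u,x)v`. -/
structure GRVA where
  grading : ℤ → Submodule ℂ V
  decomp : DirectSum.Decomposition grading
  finiteDim : ∀ k : ℤ, Module.Finite ℂ (grading k)
  lower_bounded : ∃ N : ℤ, ∀ k : ℤ, k < N → grading k = ⊥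
  Y : V →ₗ[ℂ] V →ₗ[ℂ] (ℤ → V)
  vacuum : V
  vacuum_mem : vacuum ∈ grading 0
  trunc : ∀ u v : V, ∃ N : ℤ, ∀ k : ℤ, N ≤ k → Y u v k = 0
  identity : ∀ (v : V) (k : ℤ), Y vacuum v k = if k = -1 then v else 0
  creation : ∀ (u : V) (k : ℤ), 0 ≤ k → Y u vacuum k = 0
  creation_lim : ∀ u : V, Y u vacuum (-1) = u
  L0 : Module.End ℂ V
  L0_eq : ∀ (k : ℤ) (v : V), v ∈ grading k → L0 v = (k : ℂ) • v
  Lm1 : Module.End ℂ V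
  Lm1_eq : ∀ v : V, Lm1 v = Y v vacuum (-2)
  L0_bracket : ∀ (u v : V) (k : ℤ), L0 (Y u v k)
      = Y (L0 u) v k + Y u (L0 v) k + ((-k - 1 : ℤ) : ℂ) • Y u v k
  Lm1_deriv : ∀ (u v : V) (k : ℤ), Y (Lm1 u) v k = (-k : ℂ) • Y u v (k - 1)
  Lm1_bracket : ∀ (u v : V) (k : ℤ),
      Lm1 (Y u v k) - Y u (Lm1 v) k = (-k : ℂ) • Y u v (k - 1)
  duality : ∀ (u₁ u₂ v : V) (v' : V →ₗ[ℂ] ℂ), GradedFunctionalZ grading v' →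
    ∃ f : (Fin 2 → ℂ) → ℂ, RatFull 2 f ∧
      (∀ z₁ z₂ : ℂ, ‖z₁‖ > ‖z₂‖ → z₂ ≠ 0 →
        HasSum (fun k : ℤ × ℤ =>
          v' (Y u₁ (Y u₂ v k.2) k.1) * z₁ ^ (-k.1 - 1) * z₂ ^ (-k.2 - 1)) (f ![z₁, z₂])) ∧
      (∀ z₁ z₂ : ℂ, ‖z₂‖ > ‖z₁‖ → z₁ ≠ 0 →
        HasSum (fun k : ℤ × ℤ =>
          v' (Y u₂ (Y u₁ v k.1) k.2) * z₁ ^ (-k.1 - 1) * z₂ ^ (-k.2 - 1)) (f ![z₁, z₂])) ∧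
      (∀ z₁ z₂ : ℂ, ‖z₂‖ > ‖z₁ - z₂‖ → z₁ ≠ z₂ → z₂ ≠ 0 →
        HasSum (fun k : ℤ × ℤ =>
          v' (Y (Y u₁ u₂ k.1) v k.2) * (z₁ - z₂) ^ (-k.1 - 1) * z₂ ^ (-k.2 - 1))
          (f ![z₁, z₂]))

/-- A grading-restricted generalized module structure on `W` for a
grading-restricted vertex algebra structure `A` on `V`. -/
structure GRMod (A : GRVA V) where
  grading : ℂ → Submodule ℂ W
  decomp : DirectSum.Decomposition grading
  lower_trunc : ∃ N : ℝ, ∀ c : ℂ, c.re < N → grading c = ⊥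
  Y : V →ₗ[ℂ] W →ₗ[ℂ] (ℤ → W)
  trunc : ∀ (u : V) (w : W), ∃ N : ℤ, ∀ k : ℤ, N ≤ k → Y u w k = 0
  identity : ∀ (w : W) (k : ℤ), Y A.vacuum w k = if k = -1 then w else 0
  L0 : Module.End ℂ W
  Lm1 : Module.End ℂ W
  L0_mem : ∀ (c : ℂ) (w : W), w ∈ grading c → L0 w ∈ grading c
  Lm1_mem : ∀ (c : ℂ) (w : W), w ∈ grading c → Lm1 w ∈ grading (c + 1)
  L0_bracket : ∀ (u : V) (w : W) (k : ℤ), L0 (Y u w k)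
      = Y (A.L0 u) w k + Y u (L0 w) k + ((-k - 1 : ℤ) : ℂ) • Y u w k
  L0_nilpotent : ∀ (c : ℂ) (w : W), w ∈ grading c →
      ∃ K : ℕ, ((L0 - c • 1) ^ K) w = 0
  Lm1_deriv : ∀ (u : V) (w : W) (k : ℤ), Y (A.Lm1 u) w k = (-k : ℂ) • Y u w (k - 1)
  Lm1_bracket : ∀ (u : V) (w : W) (k : ℤ),
      Lm1 (Y u w k) - Y u (Lm1 w) k = (-k : ℂ) • Y u w (k - 1)
  duality : ∀ (u₁ u₂ : V) (w : W) (w' : W →ₗ[ℂ] ℂ), GradedFunctionalC grading w' →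
    ∃ f : (Fin 2 → ℂ) → ℂ, RatFull 2 f ∧
      (∀ z₁ z₂ : ℂ, ‖z₁‖ > ‖z₂‖ → z₂ ≠ 0 →
        HasSum (fun k : ℤ × ℤ =>
          w' (Y u₁ (Y u₂ w k.2) k.1) * z₁ ^ (-k.1 - 1) * z₂ ^ (-k.2 - 1)) (f ![z₁, z₂])) ∧
      (∀ z₁ z₂ : ℂ, ‖z₂‖ > ‖z₁‖ → z₁ ≠ 0 →
        HasSum (fun k : ℤ × ℤ =>
          w' (Y u₂ (Y u₁ w k.1) k.2) * z₁ ^ (-k.1 - 1) * z₂ ^ (-k.2 - 1)) (f ![z₁, z₂])) ∧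
      (∀ z₁ z₂ : ℂ, ‖z₂‖ > ‖z₁ - z₂‖ → z₁ ≠ z₂ → z₂ ≠ 0 →
        HasSum (fun k : ℤ × ℤ =>
          w' (Y (A.Y u₁ u₂ k.1) w k.2) * (z₁ - z₂) ^ (-k.1 - 1) * z₂ ^ (-k.2 - 1))
          (f ![z₁, z₂]))

variable {V W}

/-! ## Algebraic completions -/

/-- The algebraic completion `W̄ = ∏_{c ∈ ℂ} W_(c)` of a `ℂ`-graded module. -/
abbrev WbarT {A : GRVA V} (M : GRMod V W A) : Type := ∀ c : ℂ, M.grading c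

/-- The algebraic completion `V̄ = ∏_{k ∈ ℤ} V_(k)`. -/
abbrev VbarT (A : GRVA V) : Type := ∀ k : ℤ, A.grading k

/-- The pairing `⟨w', ω⟩` of an element `w'` of the graded dual `W'` with an
element `ω` of the algebraic completion `W̄`. -/
def pairBar {A : GRVA V} {M : GRMod V W A} (w' : W →ₗ[ℂ] ℂ) (ω : WbarT M) : ℂ :=
  ∑ᶠ c : ℂ, w' (ω c : W)

/-- The pairing of an element of the graded dual `V'` with an element of `V̄`. -/
def pairBarV {A : GRVA V} (v' : V →ₗ[ℂ] ℂ) (ω : VbarT A) : ℂ :=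
  ∑ᶠ k : ℤ, v' (ω k : V)

/-- The homogeneous component `P_r ω ∈ V` of `ω ∈ V̄` for `r ∈ ℂ`
(zero when `r` is not an integer). -/
def VbarComp {A : GRVA V} (ω : VbarT A) (r : ℂ) : V :=
  if h : ∃ k : ℤ, (k : ℂ) = r then (ω h.choose : V) else 0

/-! ## Iterated vertex operators -/

/-- `applyList Yop v k L w` applies the coefficients `(Yop (v t)) · (k t)` of the
vertex operators at the positions listed in `L` (head outermost) to `w`. -/
def applyList {X : Type} [AddCommGroup X] [Module ℂ X] {n : ℕ}
    (Yop : V →ₗ[ℂ] X →ₗ[ℂ] (ℤ → X)) (v : Fin n → V) (k : Fin n → ℤ) :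
    List (Fin n) → X → X
  | [], w => w
  | t :: ts, w => Yop (v t) (applyList Yop v k ts w) (k t)

/-- The coefficient of `z^{-p-1}` in `Y^W_{WV}(w, z)v = e^{zL_W(-1)} Y_W(v, -z)w`. -/
def YWVcoef {A : GRVA V} (M : GRMod V W A) (w : W) (v : V) (p : ℤ) : W :=
  ∑ᶠ m : ℕ, (((m.factorial : ℂ))⁻¹ * (-1 : ℂ) ^ ((m : ℤ) - p)) •
    ((M.Lm1 ^ m) (M.Y v w ((m : ℤ) - p - 1)))

/-! ## The `E`-families: products of vertex operators with values in completions -/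

/-- `IsEVFam A EV` says that `EV l v z ∈ V̄` realizes
`(E^{(l)}_V(v₁ ⊗ ⋯ ⊗ v_l; 𝟏))(z₁, …, z_l) = E(Y_V(v₁,z₁) ⋯ Y_V(v_l,z_l)𝟏)`:
its pairing with every graded functional `v'` is the rational extension (with only
possible poles on the diagonals) of the series of products of `l` vertex operators
acting on the vacuum, which converges in the region `|z₁| > ⋯ > |z_l| > 0`. -/
def IsEVFam (A : GRVA V) (EV : ∀ l : ℕ, (Fin l → V) → (Fin l → ℂ) → VbarT A) : Prop :=
  ∀ (l : ℕ) (v : Fin l → V) (v' : V →ₗ[ℂ] ℂ), GradedFunctionalZ A.grading v' →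
    ∃ f : (Fin l → ℂ) → ℂ, RatDiag l f ∧
      (∀ z : Fin l → ℂ, (List.finRange l).Chain' (fun s t => ‖z s‖ > ‖z t‖) →
          (∀ t, z t ≠ 0) →
        HasSum (fun k : Fin l → ℤ =>
          v' (applyList A.Y v k (List.finRange l) A.vacuum) *
            ∏ t, z t ^ (-(k t) - 1)) (f z)) ∧
      (∀ z, (∀ s t, s ≠ t → z s ≠ z t) → pairBarV v' (EV l v z) = f z)

/-- `IsEWFam A M EW` says that `EW m v u z ∈ W̄` realizes
`(E^{(m)}_W(v₁ ⊗ ⋯ ⊗ v_m; u))(z₁, …, z_m) = E(Y_W(v₁,z₁) ⋯ Y_W(v_m,z_m)u)`: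
its pairing with every graded functional `w'` is the rational extension (with only
possible poles at `z i = z j` and `z i = 0`) of the series of products of `m` module
vertex operators acting on `u`, convergent for `|z₁| > ⋯ > |z_m| > 0`. -/
def IsEWFam {A : GRVA V} (M : GRMod V W A)
    (EW : ∀ m : ℕ, (Fin m → V) → W → (Fin m → ℂ) → WbarT M) : Prop :=
  ∀ (m : ℕ) (v : Fin m → V) (u : W) (w' : W →ₗ[ℂ] ℂ), GradedFunctionalC M.grading w' →
    ∃ f : (Fin m → ℂ) → ℂ, RatFull m f ∧
      (∀ z : Fin m → ℂ, (List.finRange m).Chain' (fun s t => ‖z s‖ > ‖z t‖) →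
          (∀ t, z t ≠ 0) →
        HasSum (fun k : Fin m → ℤ =>
          w' (applyList M.Y v k (List.finRange m) u) *
            ∏ t, z t ^ (-(k t) - 1)) (f z)) ∧
      (∀ z, (∀ s t, s ≠ t → z s ≠ z t) → (∀ t, z t ≠ 0) →
        pairBar w' (EW m v u z) = f z)

/-- `IsEWV1Fam A M G` says that `G m u v ζz ∈ W̄` realizes
`(E^{W;(1,m)}_{WV}(u; v₁ ⊗ ⋯ ⊗ v_m))(ζ, z₁, …, z_m)
  = E(Y^W_{WV}(u,ζ) Y_V(v₁,z₁) ⋯ Y_V(v_m,z_m)𝟏)`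
(first variable is the `ζ`-slot of `Y^W_{WV}`): its pairing with every graded
functional is the rational extension (poles only on diagonals) of the corresponding
series, convergent for `|ζ| > |z₁| > ⋯ > |z_m| > 0`. -/
def IsEWV1Fam {A : GRVA V} (M : GRMod V W A)
    (G : ∀ m : ℕ, W → (Fin m → V) → (Fin (m + 1) → ℂ) → WbarT M) : Prop :=
  ∀ (m : ℕ) (u : W) (v : Fin m → V) (w' : W →ₗ[ℂ] ℂ), GradedFunctionalC M.grading w' →
    ∃ f : (Fin (m + 1) → ℂ) → ℂ, RatDiag (m + 1) f ∧
      (∀ z : Fin (m + 1) → ℂ,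
          (List.finRange (m + 1)).Chain' (fun s t => ‖z s‖ > ‖z t‖) →
          (∀ t, z t ≠ 0) →
        HasSum (fun k : Fin (m + 1) → ℤ =>
          w' (YWVcoef M u
              (applyList A.Y v (fun t => k t.succ) (List.finRange m) A.vacuum) (k 0)) *
            ∏ t, z t ^ (-(k t) - 1)) (f z)) ∧
      (∀ z, (∀ s t, s ≠ t → z s ≠ z t) → pairBar w' (G m u v z) = f z)

/-- `IsEn1Fam A M E` says that `E m v u zζ ∈ W̄` realizes
`(E^{(m,1)}_W(v₁ ⊗ ⋯ ⊗ v_m; u))(z₁, …, z_m, ζ)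
  = E(Y_W(v₁,z₁) ⋯ Y_W(v_m,z_m) Y^W_{WV}(u,ζ)𝟏)`
(the last variable is the `ζ`-slot): its pairing with every graded functional is
the rational extension (poles only on diagonals) of the corresponding series,
convergent for `|z₁| > ⋯ > |z_m| > |ζ| > 0`. -/
def IsEn1Fam {A : GRVA V} (M : GRMod V W A)
    (E : ∀ m : ℕ, (Fin m → V) → W → (Fin (m + 1) → ℂ) → WbarT M) : Prop :=
  ∀ (m : ℕ) (v : Fin m → V) (u : W) (w' : W →ₗ[ℂ] ℂ), GradedFunctionalC M.grading w' →
    ∃ f : (Fin (m + 1) → ℂ) → ℂ, RatDiag (m + 1) f ∧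
      (∀ z : Fin (m + 1) → ℂ,
          (List.finRange (m + 1)).Chain' (fun s t => ‖z s‖ > ‖z t‖) →
          (∀ t, z t ≠ 0) →
        HasSum (fun k : Fin (m + 1) → ℤ =>
          w' (applyList M.Y v (fun t => k t.castSucc) (List.finRange m)
              (YWVcoef M u A.vacuum (k (Fin.last m)))) *
            ∏ t, z t ^ (-(k t) - 1)) (f z)) ∧
      (∀ z, (∀ s t, s ≠ t → z s ≠ z t) → pairBar w' (E m v u z) = f z)

/-! ## Cochains -/

/-- The space of `n`-cochains: linear maps from `V^{⊗n}` to the space of functions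
from `n`-tuples of complex numbers to `W̄` (only the restriction to the configuration
space `F_nℂ` is relevant; `W̄`-valued rationality is imposed separately). -/
abbrev Cochain {A : GRVA V} (M : GRMod V W A) (n : ℕ) :=
  MultilinearMap ℂ (fun _ : Fin n => V) ((Fin n → ℂ) → WbarT M)

/-- `Φ` takes values in `W̄`-valued rational functions with the only possible poles
at `z i = z j`, `i ≠ j` (i.e. in `W̃_{z₁,…,zₙ}`). -/
def TakesRatValues {A : GRVA V} {M : GRMod V W A} {n : ℕ} (Φ : Cochain M n) : Prop :=
  ∀ (v : Fin n → V) (w' : W →ₗ[ℂ] ℂ), GradedFunctionalC M.grading w' →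
    RatDiag n (fun z => pairBar w' (Φ v z))

/-- Pre-composition of the complex variables with an equivalence, as a linear map. -/
def precompZ {X : Type} [AddCommGroup X] [Module ℂ X] {a b : ℕ} (e : Fin a ≃ Fin b) :
    ((Fin a → ℂ) → X) →ₗ[ℂ] ((Fin b → ℂ) → X) where
  toFun f := fun zb => f (fun i => zb (e i))
  map_add' _ _ := rfl
  map_smul' _ _ := rfl

/-- Transport of a cochain along an identification of index sets; for `e = σ ∈ Sₙ`
this is the action `(σ(Φ))(v₁ ⊗ ⋯ ⊗ vₙ) = σ(Φ(v_{σ(1)} ⊗ ⋯ ⊗ v_{σ(n)}))`,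
i.e. `(transport σ Φ) v z = Φ (v ∘ σ) (z ∘ σ)`. -/
def transport {A : GRVA V} {M : GRMod V W A} {a b : ℕ} (e : Fin a ≃ Fin b)
    (Φ : Cochain M a) : Cochain M b :=
  (precompZ e).compMultilinearMap (MultilinearMap.domDomCongr e Φ)
/-! ## Operators on the algebraic completion -/

lemma Lm1_pow_mem {A : GRVA V} (M : GRMod V W A) (m : ℕ) (c : ℂ) (w : W)
    (h : w ∈ M.grading c) : (M.Lm1 ^ m) w ∈ M.grading (c + m) := by
  induction m generalizing c w with
  | zero => simpa using h
  | succ K ih =>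
    have h1 : (M.Lm1 ^ (K + 1)) w = (M.Lm1 ^ K) (M.Lm1 w) := by
      rw [pow_succ]; rfl
    have h2 := ih (c + 1) (M.Lm1 w) (M.Lm1_mem c w h)
    have h3 : c + 1 + (K : ℂ) = c + ((K : ℕ) + 1 : ℕ) := by push_cast; ring
    rw [h1]
    rw [h3] at h2
    exact h2

/-- The extension of `L_W(-1)` to the algebraic completion `W̄`. -/
def Lm1bar {A : GRVA V} (M : GRMod V W A) (ω : WbarT M) : WbarT M := fun c =>
  ⟨M.Lm1 (ω (c - 1) : W), by
    have h := M.Lm1_mem (c - 1) _ (ω (c - 1)).2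
    have h2 : c - 1 + 1 = c := by ring
    rwa [h2] at h⟩

/-- The operator `e^{ζ L_W(-1)}` on the algebraic completion `W̄`, well defined
componentwise thanks to the shift of weights and lower truncation. -/
def expLm1 {A : GRVA V} (M : GRMod V W A) (ζ : ℂ) (ω : WbarT M) : WbarT M := fun c =>
  ∑ᶠ m : ℕ, ((ζ ^ m * ((m.factorial : ℂ))⁻¹) •
    (⟨(M.Lm1 ^ m) (ω (c - m) : W), by
        have h := Lm1_pow_mem M m (c - m) _ (ω (c - m)).2
        have h2 : c - (m : ℂ) + m = c := by ring
        rwa [h2] at h⟩ : M.grading c))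

lemma L0nil_mem {A : GRVA V} (M : GRMod V W A) (K : ℕ) (c : ℂ) (w : W)
    (h : w ∈ M.grading c) : ((M.L0 - c • 1) ^ K) w ∈ M.grading c := by
  induction K generalizing w with
  | zero => simpa using h
  | succ K ih =>
    have h1 : ((M.L0 - c • 1) ^ (K + 1)) w = ((M.L0 - c • 1) ^ K) ((M.L0 - c • 1) w) := by
      rw [pow_succ]; rfl
    rw [h1]
    apply ih
    have h2 : (M.L0 - c • 1) w = M.L0 w - c • w := by
      simp [LinearMap.sub_apply]
    rw [h2]
    exact Submodule.sub_mem _ (M.L0_mem c w h) (Submodule.smul_mem _ c h)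

/-- The operator `z^{L_W(0)} = e^{(log z)(L_W(0))_s} e^{(log z)(L_W(0)-(L_W(0))_s)}`
on the algebraic completion `W̄`, defined using the semisimple part (which acts on
`W_(c)` as multiplication by `c`) and the locally nilpotent part of `L_W(0)`. -/
def zL0bar {A : GRVA V} (M : GRMod V W A) (z : ℂ) (ω : WbarT M) : WbarT M := fun c =>
  Complex.exp (Complex.log z * c) •
    ∑ᶠ K : ℕ, (((Complex.log z) ^ K * ((K.factorial : ℂ))⁻¹) •
      (⟨((M.L0 - c • 1) ^ K) (ω c : W), L0nil_mem M K c _ (ω c).2⟩ : M.grading c))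

/-- The operator `z^{L_V(0)}` on `V` (semisimple, integral weights). -/
def zL0V (A : GRVA V) (z : ℂ) (v : V) : V :=
  letI := A.decomp
  ∑ᶠ k : ℤ, (z ^ k) • ((DirectSum.decompose A.grading v k : V))

/-! ## The `L(-1)`-derivative and `L(0)`-conjugation properties -/

/-- The `L(-1)`-derivative property for a cochain `Φ`. -/
def HasL1D {A : GRVA V} {M : GRMod V W A} {n : ℕ} (Φ : Cochain M n) : Prop :=
  (∀ (v : Fin n → V) (w' : W →ₗ[ℂ] ℂ), GradedFunctionalC M.grading w' →
    ∀ (i : Fin n) (z : Fin n → ℂ), (∀ s t, s ≠ t → z s ≠ z t) →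
      HasDerivAt (fun t => pairBar w' (Φ v (Function.update z i t)))
        (pairBar w' (Φ (Function.update v i (A.Lm1 (v i))) z)) (z i)) ∧
  (∀ (v : Fin n → V) (w' : W →ₗ[ℂ] ℂ), GradedFunctionalC M.grading w' →
    ∀ z : Fin n → ℂ, (∀ s t, s ≠ t → z s ≠ z t) →
      ∑ i : Fin n, pairBar w' (Φ (Function.update v i (A.Lm1 (v i))) z)
        = pairBar w' (Lm1bar M (Φ v z)))

/-- The `L(0)`-conjugation property for a cochain `Φ`. -/
def HasL0conj {A : GRVA V} {M : GRMod V W A} {n : ℕ} (Φ : Cochain M n) : Prop :=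
  ∀ (v : Fin n → V) (w' : W →ₗ[ℂ] ℂ), GradedFunctionalC M.grading w' →
    ∀ (z : ℂ) (zs : Fin n → ℂ), z ≠ 0 → (∀ s t, s ≠ t → zs s ≠ zs t) →
      pairBar w' (zL0bar M z (Φ v zs))
        = pairBar w' (Φ (fun i => zL0V A z (v i)) (fun i => z * zs i))
/-! ## Block embeddings -/

/-- Starting index of the `i`-th block of sizes `l`. -/
def blockStart {n : ℕ} (l : Fin n → ℕ) (i : Fin n) : ℕ :=
  ∑ j ∈ Finset.univ.filter (fun j => j < i), l j

lemma blockEmb_lt {n m : ℕ} (l : Fin n → ℕ) (hsum : ∑ i, l i = m) (i : Fin n)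
    (p : Fin (l i)) : blockStart l i + (p : ℕ) < m := by
  have hp : (p : ℕ) < l i := p.2
  have h2 : blockStart l i + l i ≤ m := by
    rw [← hsum]
    have hnotin : i ∉ Finset.univ.filter (fun j => j < i) := by simp
    have : blockStart l i + l i = ∑ j ∈ insert i (Finset.univ.filter (fun j => j < i)), l j := by
      rw [Finset.sum_insert hnotin, Nat.add_comm]; rfl
    rw [this]
    exact Finset.sum_le_sum_of_subset (by intro x _; simp)
  omega

/-- The embedding of the `p`-th position of the `i`-th block into `Fin m`,
where the blocks have sizes `l 0, …, l (n-1)` with `∑ l = m`. -/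
def blockEmb {n m : ℕ} (l : Fin n → ℕ) (hsum : ∑ i, l i = m) (i : Fin n)
    (p : Fin (l i)) : Fin m :=
  ⟨blockStart l i + (p : ℕ), blockEmb_lt l hsum i p⟩

/-! ## Composability with vertex operators -/

/-- `Φ : V^{⊗n} → W̃` is composable with `m` vertex operators (Definition 3.3):
the two families of series obtained by substituting products of vertex operators
acting on the vacuum into the arguments of `Φ` (condition 1) and by applying `m`
module vertex operators to the value of `Φ` (condition 2) converge absolutely in
the indicated regions to rational functions with only possible poles at
`z i = z j` of orders bounded by positive integers `N(v i, v j)` depending only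
on `v i` and `v j`.  The auxiliary `V̄`- and `W̄`-valued products are encoded by
families `EV`, `EW` satisfying `IsEVFam`, `IsEWFam`. -/
def Composable {A : GRVA V} {M : GRMod V W A}
    (EV : ∀ l : ℕ, (Fin l → V) → (Fin l → ℂ) → VbarT A)
    (EW : ∀ m : ℕ, (Fin m → V) → W → (Fin m → ℂ) → WbarT M)
    {n : ℕ} (m : ℕ) (Φ : Cochain M n) : Prop :=
  (∃ Nb : V → V → ℕ, (∀ a b, 0 < Nb a b) ∧
    ∀ (l : Fin n → ℕ), (∀ i, 0 < l i) → ∀ (hsum : ∑ i, l i = m + n)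
      (v : Fin (m + n) → V) (w' : W →ₗ[ℂ] ℂ), GradedFunctionalC M.grading w' →
    ∃ f : (Fin (m + n) → ℂ) → ℂ,
      RatDiagBnd (m + n) (fun s t => Nb (v s) (v t)) f ∧
      ∀ (ζ : Fin n → ℂ) (z : Fin (m + n) → ℂ),
        (∀ i j : Fin n, i ≠ j → ζ i ≠ ζ j) →
        (∀ i j : Fin n, i ≠ j → ∀ (p : Fin (l i)) (q : Fin (l j)),
          ‖z (blockEmb l hsum i p) - ζ i‖ + ‖z (blockEmb l hsum j q) - ζ j‖
            < ‖ζ i - ζ j‖) →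
        (∀ (i : Fin n) (p q : Fin (l i)), p ≠ q →
          z (blockEmb l hsum i p) ≠ z (blockEmb l hsum i q)) →
        HasSum (fun r : Fin n → ℤ =>
          pairBar w' (Φ (fun i =>
            ((EV (l i) (fun p => v (blockEmb l hsum i p))
              (fun p => z (blockEmb l hsum i p) - ζ i)) (r i) : V)) ζ)) (f z)) ∧
  (∃ Nb : V → V → ℕ, (∀ a b, 0 < Nb a b) ∧
    ∀ (v : Fin (m + n) → V) (w' : W →ₗ[ℂ] ℂ), GradedFunctionalC M.grading w' →
    ∃ f : (Fin (m + n) → ℂ) → ℂ,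
      RatDiagBnd (m + n) (fun s t => Nb (v s) (v t)) f ∧
      ∀ z : Fin (m + n) → ℂ, (∀ s t, s ≠ t → z s ≠ z t) →
        (∀ (i : Fin m) (j : Fin n), ‖z (Fin.castAdd n i)‖ > ‖z (Fin.natAdd m j)‖) →
        (∀ j : Fin n, z (Fin.natAdd m j) ≠ 0) →
        HasSum (fun q : ℂ =>
          pairBar w' (EW m (fun i => v (Fin.castAdd n i))
            ((Φ (fun j => v (Fin.natAdd m j)) (fun j => z (Fin.natAdd m j)) q : W))
            (fun i => z (Fin.castAdd n i)))) (f z))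

/-- `Ψ` realizes the composition `Φ ∘ (E^{(l₁)}_{V;𝟏} ⊗ ⋯ ⊗ E^{(lₙ)}_{V;𝟏})`,
defined through the absolutely convergent series of condition 1 of composability
and rational extension. -/
def IsCompE {A : GRVA V} {M : GRMod V W A}
    (EV : ∀ l : ℕ, (Fin l → V) → (Fin l → ℂ) → VbarT A)
    {n : ℕ} (Φ : Cochain M n) (m' : ℕ) (l : Fin n → ℕ) (hsum : ∑ i, l i = m')
    (Ψ : Cochain M m') : Prop :=
  ∀ (v : Fin m' → V) (w' : W →ₗ[ℂ] ℂ), GradedFunctionalC M.grading w' →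
    RatDiag m' (fun z => pairBar w' (Ψ v z)) ∧
    ∀ (ζ : Fin n → ℂ) (z : Fin m' → ℂ),
      (∀ i j : Fin n, i ≠ j → ζ i ≠ ζ j) →
      (∀ s t : Fin m', s ≠ t → z s ≠ z t) →
      (∀ i j : Fin n, i ≠ j → ∀ (p : Fin (l i)) (q : Fin (l j)),
        ‖z (blockEmb l hsum i p) - ζ i‖ + ‖z (blockEmb l hsum j q) - ζ j‖
          < ‖ζ i - ζ j‖) →
      HasSum (fun r : Fin n → ℤ =>
        pairBar w' (Φ (fun i =>
          ((EV (l i) (fun p => v (blockEmb l hsum i p))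
            (fun p => z (blockEmb l hsum i p) - ζ i)) (r i) : V)) ζ))
        (pairBar w' (Ψ v z))

/-- `Ψ` realizes the composition `E^{(p)}_W ∘_{p+1} Φ` (applying `p` module vertex
operators to the left of the value of `Φ`), defined through the absolutely
convergent series of condition 2 of composability and rational extension. -/
def IsCompW {A : GRVA V} {M : GRMod V W A}
    (EW : ∀ m : ℕ, (Fin m → V) → W → (Fin m → ℂ) → WbarT M)
    {n : ℕ} (Φ : Cochain M n) (p : ℕ) (Ψ : Cochain M (p + n)) : Prop :=
  ∀ (v : Fin (p + n) → V) (w' : W →ₗ[ℂ] ℂ), GradedFunctionalC M.grading w' →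
    RatDiag (p + n) (fun z => pairBar w' (Ψ v z)) ∧
    ∀ z : Fin (p + n) → ℂ, (∀ s t, s ≠ t → z s ≠ z t) →
      (∀ (i : Fin p) (j : Fin n), ‖z (Fin.castAdd n i)‖ > ‖z (Fin.natAdd p j)‖) →
      (∀ j : Fin n, z (Fin.natAdd p j) ≠ 0) →
      HasSum (fun q : ℂ =>
        pairBar w' (EW p (fun i => v (Fin.castAdd n i))
          ((Φ (fun j => v (Fin.natAdd p j)) (fun j => z (Fin.natAdd p j)) q : W))
          (fun i => z (Fin.castAdd n i)))) (pairBar w' (Ψ v z))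

/-- `Ψ` realizes the composition `E^{W;(m)}_{WV} ∘₀ Φ` (substituting the value of
`Φ` into the `W`-argument of `E^{W;(m)}_{WV} = E^{W;(1,m)}_{WV}(·)(0, ·)`). -/
def IsCompWV {A : GRVA V} {M : GRMod V W A}
    (G : ∀ m : ℕ, W → (Fin m → V) → (Fin (m + 1) → ℂ) → WbarT M)
    {n : ℕ} (Φ : Cochain M n) (m : ℕ) (Ψ : Cochain M (n + m)) : Prop :=
  ∀ (v : Fin (n + m) → V) (w' : W →ₗ[ℂ] ℂ), GradedFunctionalC M.grading w' →
    RatDiag (n + m) (fun z => pairBar w' (Ψ v z)) ∧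
    ∀ z : Fin (n + m) → ℂ, (∀ s t, s ≠ t → z s ≠ z t) →
      (∀ (j : Fin m) (i : Fin n), ‖z (Fin.natAdd n j)‖ > ‖z (Fin.castAdd m i)‖) →
      (∀ i : Fin n, z (Fin.castAdd m i) ≠ 0) →
      HasSum (fun q : ℂ =>
        pairBar w' (G m
          ((Φ (fun i => v (Fin.castAdd m i)) (fun i => z (Fin.castAdd m i)) q : W))
          (fun j => v (Fin.natAdd n j))
          (Fin.cons 0 (fun j => z (Fin.natAdd n j)))))
        (pairBar w' (Ψ v z))
/-! ## Shuffles -/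

/-- `σ ∈ J_{n;p}`: `σ` preserves the order of the first `p` positions and of the
last `n - p` positions (0-indexed). -/
def IsShuffle {n : ℕ} (p : ℕ) (σ : Equiv.Perm (Fin n)) : Prop :=
  (∀ s t : Fin n, s < t → (t : ℕ) < p → σ s < σ t) ∧
  (∀ s t : Fin n, s < t → p ≤ (s : ℕ) → σ s < σ t)

/-- The shuffle condition defining the subcomplex `C^n_•(V,W)`: for every
`1 ≤ p ≤ n-1` the signed sum over shuffles of the permuted cochains vanishes
on the configuration space. -/
def ShuffleVanish {A : GRVA V} {M : GRMod V W A} {n : ℕ} (Φ : Cochain M n) : Prop :=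
  ∀ p : ℕ, 1 ≤ p → p ≤ n - 1 →
    ∀ (v : Fin n → V) (z : Fin n → ℂ), (∀ s t, s ≠ t → z s ≠ z t) →
      ∑ σ ∈ Finset.univ.filter (fun σ : Equiv.Perm (Fin n) => IsShuffle p σ),
        ((Equiv.Perm.sign σ : ℤ) : ℂ) • (transport σ Φ) v z = 0

/-! ## The coboundary operator -/

lemma sum_delta_block (n : ℕ) (i : Fin n) :
    ∑ j : Fin n, (if j = i then 2 else 1) = n + 1 := by
  have h : ∀ j : Fin n, (if j = i then 2 else 1) = (if j = i then 1 else 0) + 1 := by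
    intro j; split <;> rfl
  simp only [h, Finset.sum_add_distrib, Finset.sum_ite_eq' Finset.univ i (fun _ => 1)]
  simp [Nat.add_comm]

/-- `Θ` is a realization of the coboundary
`δ̂ⁿ(Φ) = E^{(1)}_W ∘₂ Φ + ∑_{i=1}^n (-1)^i Φ ∘ᵢ E^{(2)}_{V;𝟏}
          + (-1)^{n+1} E^{W;(1)}_{WV} ∘₀ Φ`
on the configuration space, where the three kinds of compositions are encoded by
the predicates `IsCompW`, `IsCompE`, `IsCompWV`. -/
def IsDelta {A : GRVA V} {M : GRMod V W A}
    (EV : ∀ l : ℕ, (Fin l → V) → (Fin l → ℂ) → VbarT A)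
    (EW : ∀ m : ℕ, (Fin m → V) → W → (Fin m → ℂ) → WbarT M)
    (G : ∀ m : ℕ, W → (Fin m → V) → (Fin (m + 1) → ℂ) → WbarT M)
    {n : ℕ} (Φ : Cochain M n) (Θ : Cochain M (n + 1)) : Prop :=
  ∃ (Aw : Cochain M (1 + n)) (B : Fin n → Cochain M (n + 1)) (Cw : Cochain M (n + 1)),
    IsCompW EW Φ 1 Aw ∧
    (∀ i : Fin n, IsCompE EV Φ (n + 1) (fun j => if j = i then 2 else 1)
      (sum_delta_block n i) (B i)) ∧
    IsCompWV G Φ 1 Cw ∧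
    (∀ (v : Fin (n + 1) → V) (z : Fin (n + 1) → ℂ), (∀ s t, s ≠ t → z s ≠ z t) →
      Θ v z = (transport (finCongr (Nat.add_comm 1 n)) Aw) v z
        + (∑ i : Fin n, ((-1 : ℂ) ^ ((i : ℕ) + 1)) • B i) v z
        + (((-1 : ℂ) ^ (n + 1)) • Cw) v z)

/-- Membership in `Ĉⁿₘ(V,W)` (before imposing the shuffle condition):
`W̃`-valued rationality, the `L(-1)`-derivative and `L(0)`-conjugation properties,
and composability with `m` vertex operators. -/
def HatCmem {A : GRVA V} {M : GRMod V W A}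
    (EV : ∀ l : ℕ, (Fin l → V) → (Fin l → ℂ) → VbarT A)
    (EW : ∀ m : ℕ, (Fin m → V) → W → (Fin m → ℂ) → WbarT M)
    {n : ℕ} (m : ℕ) (Φ : Cochain M n) : Prop :=
  TakesRatValues Φ ∧ HasL1D Φ ∧ HasL0conj Φ ∧ Composable EV EW m Φ

/-- Membership in `Cⁿₘ(V,W)`: membership in `Ĉⁿₘ(V,W)` together with the
vanishing of all shuffle sums. -/
def Cmem {A : GRVA V} {M : GRMod V W A}
    (EV : ∀ l : ℕ, (Fin l → V) → (Fin l → ℂ) → VbarT A)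
    (EW : ∀ m : ℕ, (Fin m → V) → W → (Fin m → ℂ) → WbarT M)
    {n : ℕ} (m : ℕ) (Φ : Cochain M n) : Prop :=
  HatCmem EV EW m Φ ∧ ShuffleVanish Φ
/-! ## The extra second coboundary `δ̂²_{1/2}` -/

/-- The data of the two combined absolutely convergent series (and their rational
extensions `f`, `g`) entering the definition of `Ĉ²_{1/2}(V,W)` and of
`δ̂²_{1/2}` for a 2-cochain `Φ`, for fixed `v₁,v₂,v₃` and `w'`. -/
def HalfDeltaData {A : GRVA V} {M : GRMod V W A}
    (EV : ∀ l : ℕ, (Fin l → V) → (Fin l → ℂ) → VbarT A)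
    (En1 : ∀ m : ℕ, (Fin m → V) → W → (Fin (m + 1) → ℂ) → WbarT M)
    (G : ∀ m : ℕ, W → (Fin m → V) → (Fin (m + 1) → ℂ) → WbarT M)
    (Φ : Cochain M 2) (v : Fin 3 → V) (w' : W →ₗ[ℂ] ℂ)
    (f g : (Fin 3 → ℂ) → ℂ) : Prop :=
  RatFull 3 f ∧ RatFull 3 g ∧
  (∀ z₁ z₂ z₃ ζ : ℂ, ‖z₁ - ζ‖ > ‖z₂ - ζ‖ → ‖z₁ - ζ‖ > ‖z₃ - ζ‖ →
      z₂ ≠ ζ → z₃ ≠ ζ → z₂ ≠ z₃ → z₁ ≠ ζ →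
    HasSum (fun r : ℂ =>
      pairBar w' (En1 1 ![v 0] ((Φ ![v 1, v 2] ![z₂ - ζ, z₃ - ζ]) r : W) ![z₁, ζ])
      + pairBar w' (Φ ![v 0, VbarComp (EV 2 ![v 1, v 2] ![z₂ - ζ, z₃ - ζ]) r] ![z₁, ζ]))
      (f ![z₁, z₂, z₃])) ∧
  (∀ z₁ z₂ z₃ ζ : ℂ, ‖ζ - z₃‖ > ‖z₁ - ζ‖ → ‖ζ - z₃‖ > ‖z₂ - ζ‖ →
      z₁ ≠ ζ → z₂ ≠ ζ → z₁ ≠ z₂ → ζ ≠ z₃ →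
    HasSum (fun r : ℂ =>
      pairBar w' (Φ ![VbarComp (EV 2 ![v 0, v 1] ![z₁ - ζ, z₂ - ζ]) r, v 2] ![ζ, z₃])
      + pairBar w' (G 1 ((Φ ![v 0, v 1] ![z₁ - ζ, z₂ - ζ]) r : W) ![v 2] ![ζ, z₃]))
      (g ![z₁, z₂, z₃]))

/-- Membership in `Ĉ²_{1/2}(V,W)`: the two combined series converge absolutely to
rational functions with the only possible poles at `zᵢ = zⱼ` and `zᵢ = 0`. -/
def HalfComposable {A : GRVA V} {M : GRMod V W A}
    (EV : ∀ l : ℕ, (Fin l → V) → (Fin l → ℂ) → VbarT A)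
    (En1 : ∀ m : ℕ, (Fin m → V) → W → (Fin (m + 1) → ℂ) → WbarT M)
    (G : ∀ m : ℕ, W → (Fin m → V) → (Fin (m + 1) → ℂ) → WbarT M)
    (Φ : Cochain M 2) : Prop :=
  ∀ (v : Fin 3 → V) (w' : W →ₗ[ℂ] ℂ), GradedFunctionalC M.grading w' →
    ∃ f g : (Fin 3 → ℂ) → ℂ, HalfDeltaData EV En1 G Φ v w' f g

/-- `Ξ` realizes `δ̂²_{1/2}(Φ)`: the difference of the rational extensions of
the two combined series. -/
def IsDeltaHalf {A : GRVA V} {M : GRMod V W A}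
    (EV : ∀ l : ℕ, (Fin l → V) → (Fin l → ℂ) → VbarT A)
    (En1 : ∀ m : ℕ, (Fin m → V) → W → (Fin (m + 1) → ℂ) → WbarT M)
    (G : ∀ m : ℕ, W → (Fin m → V) → (Fin (m + 1) → ℂ) → WbarT M)
    (Φ : Cochain M 2) (Ξ : Cochain M 3) : Prop :=
  ∀ (v : Fin 3 → V) (w' : W →ₗ[ℂ] ℂ), GradedFunctionalC M.grading w' →
    ∃ f g : (Fin 3 → ℂ) → ℂ, HalfDeltaData EV En1 G Φ v w' f g ∧
      ∀ z : Fin 3 → ℂ, (∀ s t, s ≠ t → z s ≠ z t) →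
        pairBar w' (Ξ v z) = f z - g z

/-! ## Cocycles and coboundaries -/

/-- `Φ ∈ C^n_m(V,W)` is a cocycle: every realization of `δ̂ⁿₘ(Φ)` vanishes on the
configuration space. -/
def IsCocycle {A : GRVA V} {M : GRMod V W A}
    (EV : ∀ l : ℕ, (Fin l → V) → (Fin l → ℂ) → VbarT A)
    (EW : ∀ m : ℕ, (Fin m → V) → W → (Fin m → ℂ) → WbarT M)
    (G : ∀ m : ℕ, W → (Fin m → V) → (Fin (m + 1) → ℂ) → WbarT M)
    {n : ℕ} (m : ℕ) (Φ : Cochain M n) : Prop :=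
  Cmem EV EW m Φ ∧
    ∀ Θ : Cochain M (n + 1), IsDelta EV EW G Φ Θ →
      ∀ (v : Fin (n + 1) → V) (z : Fin (n + 1) → ℂ),
        (∀ s t, s ≠ t → z s ≠ z t) → Θ v z = 0

/-- `Φ` is a coboundary at level `m`: it agrees on the configuration space with a
realization of `δ̂ⁿ_{m+1}(Ψ)` for some `Ψ ∈ Cⁿ_{m+1}(V,W)`. -/
def IsCobound {A : GRVA V} {M : GRMod V W A}
    (EV : ∀ l : ℕ, (Fin l → V) → (Fin l → ℂ) → VbarT A)
    (EW : ∀ m : ℕ, (Fin m → V) → W → (Fin m → ℂ) → WbarT M)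
    (G : ∀ m : ℕ, W → (Fin m → V) → (Fin (m + 1) → ℂ) → WbarT M)
    {n : ℕ} (m : ℕ) (Φ : Cochain M (n + 1)) : Prop :=
  ∃ Ψ : Cochain M n, Cmem EV EW (m + 1) Ψ ∧
    ∃ Θ : Cochain M (n + 1), IsDelta EV EW G Ψ Θ ∧
      ∀ (v : Fin (n + 1) → V) (z : Fin (n + 1) → ℂ),
        (∀ s t, s ≠ t → z s ≠ z t) → Θ v z = Φ v z

/-! ## Symmetry of rational functions under permutations of the variables -/

lemma prod_prod_ite_lt_eq {R : Type*} [CommMonoid R] {n : ℕ} (F : Fin n → Fin n → R) :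
    ∏ i : Fin n, ∏ j : Fin n, (if i < j then F i j else 1) =
      ∏ p ∈ Finset.univ.filter (fun p : Fin n × Fin n => p.1 < p.2), F p.1 p.2 := by
  rw [Finset.prod_filter, Fintype.prod_prod_type]

/-- A product of powers of differences over pairs divides, after permuting the indices,
the analogous product with larger symmetric exponents. -/
lemma prod_sub_pow_perm_dvd {R : Type*} [CommRing R] {n : ℕ} (x : Fin n → R)
    (e : Equiv.Perm (Fin n)) {N N' : Fin n → Fin n → ℕ} (hsymm : ∀ i j, N' i j = N' j i)
    (hle : ∀ i j, N i j ≤ N' (e i) (e j)) :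
    (∏ i : Fin n, ∏ j : Fin n, (if i < j then (x (e i) - x (e j)) ^ N i j else 1)) ∣
      ∏ i : Fin n, ∏ j : Fin n, (if i < j then (x i - x j) ^ N' i j else 1) := by
  rw [prod_prod_ite_lt_eq, prod_prod_ite_lt_eq (fun i j => (x i - x j) ^ N' i j)]
  set S := Finset.univ.filter (fun p : Fin n × Fin n => p.1 < p.2)
  let φ : Fin n × Fin n → Fin n × Fin n := fun p =>
    if e p.1 < e p.2 then (e p.1, e p.2) else (e p.2, e p.1)
  have hφS : S.image φ ⊆ S := by
    intro q hq
    obtain ⟨p, hp, rfl⟩ := Finset.mem_image.1 hq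
    have hp' : p.1 < p.2 := by simpa [S] using hp
    have hne : e p.1 ≠ e p.2 := e.injective.ne hp'.ne
    by_cases h : e p.1 < e p.2
    · simp [S, φ, h]
    · simpa [S, φ, h] using lt_of_le_of_ne (not_lt.1 h) hne.symm
  have hφinj : Set.InjOn φ S := by
    rintro ⟨a, b⟩ hp ⟨c, d⟩ hq h
    have hab : a < b := by simpa [S] using hp
    have hcd : c < d := by simpa [S] using hq
    simp only [φ] at h
    split_ifs at h <;> simp only [Prod.mk.injEq, e.injective.eq_iff] at h ⊢
    · exact h
    · exact absurd hab (by rw [h.1, h.2]; exact hcd.not_gt)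
    · exact absurd hab (by rw [h.1, h.2]; exact hcd.not_gt)
    · exact h.symm
  calc ∏ p ∈ S, (x (e p.1) - x (e p.2)) ^ N p.1 p.2
      ∣ ∏ p ∈ S, (x (φ p).1 - x (φ p).2) ^ N' (φ p).1 (φ p).2 := by
        refine Finset.prod_dvd_prod_of_dvd _ _ fun p _ => ?_
        by_cases h : e p.1 < e p.2
        · simpa [φ, h] using pow_dvd_pow _ (hle p.1 p.2)
        · simp only [φ, h, if_false]
          rw [hsymm]
          refine (pow_dvd_pow _ (hle p.1 p.2)).trans (pow_dvd_pow_of_dvd ?_ _)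
          rw [← neg_sub, neg_dvd]
    _ = ∏ q ∈ S.image φ, (x q.1 - x q.2) ^ N' q.1 q.2 :=
        (Finset.prod_image (f := fun q : Fin n × Fin n => (x q.1 - x q.2) ^ N' q.1 q.2)
          hφinj).symm
    _ ∣ _ := Finset.prod_dvd_prod_of_subset _ _ _ hφS

lemma RatDiagBnd.comp_perm {n : ℕ} {N N' : Fin n → Fin n → ℕ} {f : (Fin n → ℂ) → ℂ}
    (hf : RatDiagBnd n N f) (e : Equiv.Perm (Fin n)) (hsymm : ∀ i j, N' i j = N' j i)
    (hle : ∀ i j, N i j ≤ N' (e i) (e j)) :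
    RatDiagBnd n N' (fun z => f (z ∘ e)) := by
  obtain ⟨P, hP⟩ := hf
  obtain ⟨Q, hQ⟩ := prod_sub_pow_perm_dvd
    (MvPolynomial.X : Fin n → MvPolynomial (Fin n) ℂ) e hsymm hle
  refine ⟨MvPolynomial.rename e P * Q, fun z hz => ?_⟩
  have hQz := congrArg (MvPolynomial.eval z) hQ
  simp only [map_mul, map_prod, apply_ite (MvPolynomial.eval z), map_pow, map_sub,
    MvPolynomial.eval_X, map_one] at hQz
  rw [hQz, ← mul_assoc, map_mul, MvPolynomial.eval_rename,
    ← hP (z ∘ e) fun i j hij => hz _ _ (e.injective.ne hij)]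
  rfl

lemma RatDiag.comp_perm {n : ℕ} {f : (Fin n → ℂ) → ℂ} (hf : RatDiag n f)
    (e : Equiv.Perm (Fin n)) : RatDiag n (fun z => f (z ∘ e)) := by
  obtain ⟨P, N, hP⟩ := hf
  obtain ⟨Q, hQ⟩ := RatDiagBnd.comp_perm (N := fun _ _ => N) (N' := fun _ _ => N) ⟨P, hP⟩ e
    (fun _ _ => rfl) (fun _ _ => le_rfl)
  exact ⟨Q, N, hQ⟩

/-! ## Permutations of blocks -/

lemma blockStart_add_le {n : ℕ} (l : Fin n → ℕ) {i j : Fin n} (h : i < j) :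
    blockStart l i + l i ≤ blockStart l j := by
  have hnotin : i ∉ Finset.univ.filter (fun k => k < i) := by simp
  have heq : blockStart l i + l i =
      ∑ k ∈ insert i (Finset.univ.filter (fun k => k < i)), l k := by
    rw [Finset.sum_insert hnotin, Nat.add_comm]; rfl
  rw [heq]
  refine Finset.sum_le_sum_of_subset fun k hk => ?_
  simp only [Finset.mem_insert, Finset.mem_filter, Finset.mem_univ, true_and] at hk ⊢
  rcases hk with rfl | hk
  · exact h
  · exact hk.trans h

lemma blockEmb_sigma_bijective {n m : ℕ} (l : Fin n → ℕ) (hsum : ∑ i, l i = m) :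
    Function.Bijective (fun x : Σ i, Fin (l i) => blockEmb l hsum x.1 x.2) := by
  rw [Fintype.bijective_iff_injective_and_card]
  refine ⟨?_, by simp [hsum]⟩
  rintro ⟨i, p⟩ ⟨j, q⟩ h
  have hval : blockStart l i + (p : ℕ) = blockStart l j + (q : ℕ) := congrArg Fin.val h
  have hp := p.2
  have hq := q.2
  rcases lt_trichotomy i j with hij | rfl | hij
  · have := blockStart_add_le l hij
    omega
  · have hpq : p = q := Fin.ext (by omega)
    rw [hpq]
  · have := blockStart_add_le l hij
    omega

/-- A permutation of the blocks is induced by a permutation of the positions. -/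
lemma exists_perm_blockEmb {n m : ℕ} (σ : Equiv.Perm (Fin n)) (l : Fin n → ℕ)
    (hsum : ∑ i, l i = m) (hsum' : ∑ i, l (σ i) = m) :
    ∃ e : Equiv.Perm (Fin m), ∀ (i : Fin n) (p : Fin (l (σ i))),
      e (blockEmb (fun i => l (σ i)) hsum' i p) = blockEmb l hsum (σ i) p := by
  let b := Equiv.ofBijective _ (blockEmb_sigma_bijective l hsum)
  let b' := Equiv.ofBijective _ (blockEmb_sigma_bijective (fun i => l (σ i)) hsum')
  let s : (Σ i, Fin (l (σ i))) ≃ Σ i, Fin (l i) :=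
    Equiv.sigmaCongrLeft (β := fun i => Fin (l i)) σ
  refine ⟨(b'.symm.trans s).trans b, fun i p => ?_⟩
  have hb : b'.symm (blockEmb (fun i => l (σ i)) hsum' i p) = ⟨i, p⟩ :=
    b'.symm_apply_apply ⟨i, p⟩
  simp only [Equiv.trans_apply, hb]
  rfl

/-- A permutation of the last `n` of `m + n` positions. -/
lemma exists_perm_natAdd (m : ℕ) {n : ℕ} (σ : Equiv.Perm (Fin n)) :
    ∃ e : Equiv.Perm (Fin (m + n)), (∀ i, e (Fin.castAdd n i) = Fin.castAdd n i) ∧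
      ∀ j, e (Fin.natAdd m j) = Fin.natAdd m (σ j) :=
  ⟨finSumFinEquiv.permCongr (Equiv.sumCongr (Equiv.refl _) σ),
    by simp [Equiv.permCongr_apply], by simp [Equiv.permCongr_apply]⟩

/-! ## Invariance under the action of the symmetric group -/

section SymmetricGroupAction

variable {A : GRVA V} {M : GRMod V W A}

lemma transport_perm_apply {n : ℕ} (σ : Equiv.Perm (Fin n)) (Φ : Cochain M n)
    (v : Fin n → V) (z : Fin n → ℂ) : transport σ Φ v z = Φ (v ∘ σ) (z ∘ σ) := rfl

lemma TakesRatValues.transport_perm {n : ℕ} {Φ : Cochain M n} (h : TakesRatValues Φ)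
    (σ : Equiv.Perm (Fin n)) : TakesRatValues (transport σ Φ) :=
  fun v w' hw' => (h (v ∘ σ) w' hw').comp_perm σ

lemma HasL1D.transport_perm {n : ℕ} {Φ : Cochain M n} (h : HasL1D Φ)
    (σ : Equiv.Perm (Fin n)) : HasL1D (transport σ Φ) := by
  refine ⟨fun v w' hw' i z hz => ?_, fun v w' hw' z hz => ?_⟩
  · have h1 := h.1 (v ∘ σ) w' hw' (σ.symm i) (z ∘ σ)
      fun s t hst => hz _ _ (σ.injective.ne hst)
    simpa only [transport_perm_apply, Function.update_comp_equiv, Function.comp_apply,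
      Equiv.apply_symm_apply] using h1
  · have h2 := h.2 (v ∘ σ) w' hw' (z ∘ σ) fun s t hst => hz _ _ (σ.injective.ne hst)
    rw [transport_perm_apply, ← h2, ← Equiv.sum_comp σ]
    simp only [transport_perm_apply, Function.update_comp_equiv, Function.comp_apply,
      Equiv.symm_apply_apply]

lemma HasL0conj.transport_perm {n : ℕ} {Φ : Cochain M n} (h : HasL0conj Φ)
    (σ : Equiv.Perm (Fin n)) : HasL0conj (transport σ Φ) :=
  fun v w' hw' z zs hz hzs =>
    h (v ∘ σ) w' hw' z (zs ∘ σ) hz fun _ _ hst => hzs _ _ (σ.injective.ne hst)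

lemma Composable.transport_perm {EV : ∀ l : ℕ, (Fin l → V) → (Fin l → ℂ) → VbarT A}
    {EW : ∀ m : ℕ, (Fin m → V) → W → (Fin m → ℂ) → WbarT M} {n m : ℕ} {Φ : Cochain M n}
    (h : Composable EV EW m Φ) (σ : Equiv.Perm (Fin n)) :
    Composable EV EW m (transport σ Φ) := by
  obtain ⟨⟨N₁, hN₁, h₁⟩, ⟨N₂, hN₂, h₂⟩⟩ := h
  refine ⟨⟨fun a b => N₁ a b + N₁ b a, fun a b => Nat.add_pos_left (hN₁ a b) _, ?_⟩,
    ⟨fun a b => N₂ a b + N₂ b a, fun a b => Nat.add_pos_left (hN₂ a b) _, ?_⟩⟩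
  · intro l hl hsum v w' hw'
    have hsum' : ∑ i, l (σ i) = m + n := (Equiv.sum_comp σ l).trans hsum
    obtain ⟨e, he⟩ := exists_perm_blockEmb σ l hsum hsum'
    obtain ⟨f, hf, hfsum⟩ := h₁ (fun i => l (σ i)) (fun i => hl _) hsum' (v ∘ e) w' hw'
    refine ⟨fun z => f (z ∘ e), hf.comp_perm e (fun _ _ => Nat.add_comm _ _)
      (fun _ _ => Nat.le_add_right _ _), fun ζ z hζ hdisj hz => ?_⟩
    have key := hfsum (ζ ∘ σ) (z ∘ e) (fun i j hij => hζ _ _ (σ.injective.ne hij))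
      (fun i j hij p q => by
        simpa only [Function.comp_apply, he] using hdisj _ _ (σ.injective.ne hij) p q)
      (fun i p q hpq => by simpa only [Function.comp_apply, he] using hz (σ i) p q hpq)
    simp only [Function.comp_apply, he] at key
    exact (Equiv.hasSum_iff (σ.arrowCongr (Equiv.refl ℤ)).symm).2 key
  · intro v w' hw'
    obtain ⟨e, he_cast, he_nat⟩ := exists_perm_natAdd m σ
    obtain ⟨f, hf, hfsum⟩ := h₂ (v ∘ e) w' hw'
    refine ⟨fun z => f (z ∘ e), hf.comp_perm e (fun _ _ => Nat.add_comm _ _)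
      (fun _ _ => Nat.le_add_right _ _), fun z hz hdom hz0 => ?_⟩
    have key := hfsum (z ∘ e) (fun s t hst => hz _ _ (e.injective.ne hst))
      (fun i j => by simpa only [Function.comp_apply, he_cast, he_nat] using hdom i (σ j))
      (fun j => by simpa only [Function.comp_apply, he_nat] using hz0 (σ j))
    simp only [Function.comp_apply, he_cast, he_nat] at key
    exact key

end SymmetricGroupAction

/-- Proposition 3.7: the subspaces of
`Hom(V^{⊗n}, W̃_{z₁,…,zₙ})` of maps with values in `W̃`, of maps with the
`L(-1)`-derivative property, of maps with the `L(0)`-conjugation property, and of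
maps composable with `m` vertex operators, are invariant under the `Sₙ`-action
`(σ(Φ))(v₁⊗⋯⊗vₙ) = σ(Φ(v_{σ(1)}⊗⋯⊗v_{σ(n)}))` (here `transport σ`). -/
theorem Sn_action_invariance
    (A : GRVA V) (M : GRMod V W A)
    (EV : ∀ l : ℕ, (Fin l → V) → (Fin l → ℂ) → VbarT A) (hEV : IsEVFam A EV)
    (EW : ∀ m : ℕ, (Fin m → V) → W → (Fin m → ℂ) → WbarT M) (hEW : IsEWFam M EW)
    (n : ℕ) (σ : Equiv.Perm (Fin n)) (Φ : Cochain M n) :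
    (TakesRatValues Φ → TakesRatValues (transport σ Φ)) ∧
    (HasL1D Φ → HasL1D (transport σ Φ)) ∧
    (HasL0conj Φ → HasL0conj (transport σ Φ)) ∧
    (∀ m : ℕ, Composable EV EW m Φ → Composable EV EW m (transport σ Φ)) :=
  ⟨fun h => h.transport_perm σ, fun h => h.transport_perm σ, fun h => h.transport_perm σ,
    fun _ h => h.transport_perm σ⟩
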